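/- arXiv:0704.0195 — 2 statements merged into one kernel-verified Lean document; each statement's English description precedes it below -/
import Mathlib

section
/- Let (G,q) be a nondegenerate metric group and H an isotropic subgroup. Then: (1) H ⊆ H^⊥; (2) q is constant on the cosets of H contained in H^⊥, so q induces a well-defined map q̄ on the quotient group H^⊥/H by q̄(gH) = q(g); (3) (H^⊥/H, q̄) is a nondegenerate metric group; and (4) |H^⊥/H| = |G|/|H|². -/
/-- The bimultiplicative form associated to a quadratic form `q` on a group:
`b(g,h) = q(g*h) * q(g)⁻¹ * q(h)⁻¹`. -/
def metricForm {G : Type*} [Group G] (q : G → ℂˣ) (g h : G) : ℂˣ :=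
  q (g * h) * (q g)⁻¹ * (q h)⁻¹

theorem metricForm_comm {G : Type*} [CommGroup G] (q : G → ℂˣ) (g h : G) :
    metricForm q g h = metricForm q h g := by
  simp only [metricForm, mul_comm g h, mul_right_comm]

theorem map_mul_eq_of_metricForm_eq_one {G : Type*} [Group G] {q : G → ℂˣ} {g h : G}
    (hgh : metricForm q g h = 1) : q (g * h) = q g * q h := by
  rwa [metricForm, mul_assoc, ← mul_inv_rev, mul_inv_eq_one, mul_comm (q h)] at hgh

/-- The homomorphism `g ↦ b(g, ·)` from `G` to its character group. -/
def metricFormHom {G : Type*} [CommGroup G] (q : G → ℂˣ)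
    (hq : ∀ g₁ g₂ h : G, metricForm q (g₁ * g₂) h = metricForm q g₁ h * metricForm q g₂ h) :
    G →* G →* ℂˣ :=
  MonoidHom.mk'
    (fun g ↦ MonoidHom.mk' (metricForm q g) fun h₁ h₂ ↦ by
      rw [metricForm_comm, hq, metricForm_comm q h₁, metricForm_comm q h₂])
    fun g₁ g₂ ↦ MonoidHom.ext fun h ↦ hq g₁ g₂ h

section Duality

variable {G : Type*} [CommGroup G] [Finite G]

theorem bijective_of_forall_apply_eq_one {B : G →* G →* ℂˣ}
    (hB : ∀ g, (∀ h, B g h = 1) → g = 1) : Function.Bijective B :=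
  (Nat.bijective_iff_injective_and_card _).mpr
    ⟨(injective_iff_map_eq_one B).mpr fun g hg ↦ hB g fun h ↦ by rw [hg, MonoidHom.one_apply],
      (CommGroup.card_monoidHom_of_hasEnoughRootsOfUnity G ℂ).symm⟩

/-- The annihilator of a subgroup `H` under a perfect pairing has index `|H|`. -/
theorem index_eq_card_of_bijective {B : G →* G →* ℂˣ} (hB : Function.Bijective B)
    {H K : Subgroup G} (hK : ∀ g, g ∈ K ↔ ∀ h ∈ H, B g h = 1) :
    K.index = Nat.card H := by
  have hker : K = ((MonoidHom.domRestrictHom H ℂˣ).comp B).ker := by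
    ext g
    simp [hK, MonoidHom.mem_ker, MonoidHom.domRestrict_eq_one_iff]
  have hsurj : Function.Surjective ((MonoidHom.domRestrictHom H ℂˣ).comp B) :=
    (MonoidHom.domRestrict_surjective ℂ H).comp hB.surjective
  rw [hker, Subgroup.index_ker, MonoidHom.range_eq_top.mpr hsurj, Subgroup.card_top,
    CommGroup.card_monoidHom_of_hasEnoughRootsOfUnity]

/-- The double annihilator of a subgroup under a perfect pairing is contained in the subgroup. -/
theorem mem_of_forall_mem_annihilator {B : G →* G →* ℂˣ} (hB : Function.Surjective B)
    {H K : Subgroup G} (hK : ∀ g, g ∈ K ↔ ∀ h ∈ H, B g h = 1) {g : G}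
    (hg : ∀ k ∈ K, B k g = 1) : g ∈ H := by
  rw [← CommGroup.forall_monoidHom_apply_eq_one_iff ℂ]
  intro φ hφ
  obtain ⟨k, rfl⟩ := hB φ
  exact hg k ((hK k).mpr hφ)

end Duality

/-- Let `(G,q)` be a nondegenerate metric group and `H` an isotropic
subgroup, with `Hperp` its orthogonal complement. Then (1) `H ⊆ H^⊥`; (2) `q` is
constant on cosets of `H` inside `H^⊥`; (3) `q` descends to a map `q̄` on `H^⊥/H`
making it a nondegenerate metric group; (4) `|H^⊥/H| = |G|/|H|²`. -/
theorem isotropic_quotient_is_nondeg_metric_group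
    {G : Type*} [CommGroup G] [Fintype G] (q : G → ℂˣ)
    (hq1 : ∀ g : G, q g⁻¹ = q g)
    (hq2 : ∀ g₁ g₂ h : G, metricForm q (g₁ * g₂) h = metricForm q g₁ h * metricForm q g₂ h)
    (hnd : ∀ g : G, (∀ h : G, metricForm q g h = 1) → g = 1)
    (H Hperp : Subgroup G)
    (hiso : ∀ h ∈ H, q h = 1)
    (hperp : (Hperp : Set G) = {g : G | ∀ h ∈ H, metricForm q g h = 1}) :
    H ≤ Hperp ∧
    (∀ g ∈ Hperp, ∀ h ∈ H, q (g * h) = q g) ∧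
    (∃ qbar : ↥Hperp ⧸ H.subgroupOf Hperp → ℂˣ,
      (∀ g : ↥Hperp, qbar (QuotientGroup.mk g) = q (g : G)) ∧
      (∀ x, qbar x⁻¹ = qbar x) ∧
      (∀ x₁ x₂ y, metricForm qbar (x₁ * x₂) y
          = metricForm qbar x₁ y * metricForm qbar x₂ y) ∧
      (∀ x, (∀ y, metricForm qbar x y = 1) → x = 1)) ∧
    Nat.card (↥Hperp ⧸ H.subgroupOf Hperp) = Nat.card G / (Nat.card ↥H) ^ 2 := by
  have hmem (g : G) : g ∈ Hperp ↔ ∀ h ∈ H, metricForm q g h = 1 := by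
    rw [← SetLike.mem_coe, hperp, Set.mem_ofPred_eq]
  have hB : Function.Bijective (metricFormHom q hq2) := bijective_of_forall_apply_eq_one hnd
  have hle : H ≤ Hperp := fun g hg ↦ (hmem g).mpr fun h hh ↦ by
    simp [metricForm, hiso g hg, hiso h hh, hiso _ (H.mul_mem hg hh)]
  have hcoset (g : G) (hg : g ∈ Hperp) (h : G) (hh : h ∈ H) : q (g * h) = q g := by
    rw [map_mul_eq_of_metricForm_eq_one ((hmem g).mp hg h hh), hiso h hh, mul_one]
  refine ⟨hle, hcoset, ⟨Quotient.lift (fun g : Hperp ↦ q g) ?_, fun _ ↦ rfl, ?_, ?_, ?_⟩, ?_⟩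
  · intro a b hab
    have hab' : a⁻¹ * b ∈ H.subgroupOf Hperp := QuotientGroup.leftRel_apply.mp hab
    simpa using (hcoset a a.2 _ (Subgroup.mem_subgroupOf.mp hab')).symm
  · rintro ⟨g⟩
    exact hq1 g
  · rintro ⟨g₁⟩ ⟨g₂⟩ ⟨h⟩
    exact hq2 g₁ g₂ h
  · rintro ⟨g⟩ hg
    refine (QuotientGroup.eq_one_iff g).mpr (Subgroup.mem_subgroupOf.mpr ?_)
    refine mem_of_forall_mem_annihilator hB.surjective hmem fun k hk ↦ ?_
    exact (metricForm_comm q k g).trans (hg (QuotientGroup.mk ⟨k, hk⟩))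
  · have hG : Nat.card Hperp * Nat.card H = Nat.card G := by
      rw [← index_eq_card_of_bijective hB hmem, Subgroup.card_mul_index]
    have hquot := (H.subgroupOf Hperp).card_eq_card_quotient_mul_card_subgroup
    rw [Nat.card_congr (Subgroup.subgroupOfEquivOfLe hle).toEquiv] at hquot
    rw [← hG, hquot, mul_assoc, ← sq, Nat.mul_div_cancel _ (pow_pos Nat.card_pos 2)]
end

section
/- Let (G,q) be a metric group and x ∈ G an element of order 2^k with k ≥ 3. Then q(x^{2^{k-1}}) = 1; consequently the cyclic subgroup generated by x^{2^{k-1}} is a nontrivial isotropic subgroup of G of order 2. -/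
section MetricForm

variable {G : Type*} [CommGroup G] {q : G → ℂˣ}

theorem metricForm_one_left
    (hq : ∀ g₁ g₂ h : G, metricForm q (g₁ * g₂) h = metricForm q g₁ h * metricForm q g₂ h)
    (h : G) : metricForm q 1 h = 1 := by
  simpa using hq 1 1 h

theorem map_one_of_metricForm_mul_left
    (hq : ∀ g₁ g₂ h : G, metricForm q (g₁ * g₂) h = metricForm q g₁ h * metricForm q g₂ h) :
    q 1 = 1 := by
  simpa [metricForm] using metricForm_one_left hq 1

theorem metricForm_pow_left
    (hq : ∀ g₁ g₂ h : G, metricForm q (g₁ * g₂) h = metricForm q g₁ h * metricForm q g₂ h)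
    (g h : G) (n : ℕ) : metricForm q (g ^ n) h = metricForm q g h ^ n := by
  induction n with
  | zero => simpa using metricForm_one_left hq h
  | succ n ih => rw [pow_succ, hq, ih, pow_succ]

theorem metricForm_self (hinv : ∀ g : G, q g⁻¹ = q g)
    (hq : ∀ g₁ g₂ h : G, metricForm q (g₁ * g₂) h = metricForm q g₁ h * metricForm q g₂ h)
    (g : G) : metricForm q g g = q g ^ 2 := by
  have key := hq g g⁻¹ g
  have hneg : metricForm q g⁻¹ g = (q g ^ 2)⁻¹ := by
    simp [metricForm, hinv, map_one_of_metricForm_mul_left hq, pow_two]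
  rw [mul_inv_cancel, metricForm_one_left hq, hneg] at key
  exact mul_inv_eq_one.mp key.symm

theorem map_sq_of_metricForm_mul_left (hinv : ∀ g : G, q g⁻¹ = q g)
    (hq : ∀ g₁ g₂ h : G, metricForm q (g₁ * g₂) h = metricForm q g₁ h * metricForm q g₂ h)
    (g : G) : q (g ^ 2) = q g ^ 4 := by
  have h := metricForm_self hinv hq g
  rw [metricForm, mul_inv_eq_iff_eq_mul, mul_inv_eq_iff_eq_mul] at h
  rw [pow_two g, h, ← pow_succ, ← pow_succ]

theorem map_pow_two_pow_of_metricForm_mul_left (hinv : ∀ g : G, q g⁻¹ = q g)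
    (hq : ∀ g₁ g₂ h : G, metricForm q (g₁ * g₂) h = metricForm q g₁ h * metricForm q g₂ h)
    (g : G) (n : ℕ) : q (g ^ 2 ^ n) = q g ^ 4 ^ n := by
  induction n with
  | zero => simp
  | succ n ih =>
    rw [pow_succ 2, pow_mul, map_sq_of_metricForm_mul_left hinv hq, ih, ← pow_mul, ← pow_succ]

theorem map_pow_two_mul_eq_one (hinv : ∀ g : G, q g⁻¹ = q g)
    (hq : ∀ g₁ g₂ h : G, metricForm q (g₁ * g₂) h = metricForm q g₁ h * metricForm q g₂ h)
    {g : G} {n : ℕ} (hg : g ^ n = 1) : q g ^ (2 * n) = 1 := by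
  rw [pow_mul, ← metricForm_self hinv hq, ← metricForm_pow_left hq, hg, metricForm_one_left hq]

end MetricForm

/-- Let `(G,q)` be a metric group and `x ∈ G` an element of order
`2^k` with `k ≥ 3`. Then `q(x^(2^(k-1))) = 1`, so the cyclic subgroup generated by
`x^(2^(k-1))` is a nontrivial isotropic subgroup of order `2`. -/
theorem isotropic_element_in_two_power_order
    {G : Type*} [CommGroup G] (q : G → ℂˣ)
    (hq1 : ∀ g : G, q g⁻¹ = q g)
    (hq2 : ∀ g₁ g₂ h : G, metricForm q (g₁ * g₂) h = metricForm q g₁ h * metricForm q g₂ h)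
    (k : ℕ) (hk : 3 ≤ k)
    (x : G) (hx : orderOf x = 2 ^ k) :
    q (x ^ 2 ^ (k - 1)) = 1 ∧
    (∀ h ∈ Subgroup.zpowers (x ^ 2 ^ (k - 1)), q h = 1) ∧
    Subgroup.zpowers (x ^ 2 ^ (k - 1)) ≠ ⊥ ∧
    Nat.card ↥(Subgroup.zpowers (x ^ 2 ^ (k - 1))) = 2 := by
  have hq : q (x ^ 2 ^ (k - 1)) = 1 := by
    have hdvd : 2 * 2 ^ k ∣ 4 ^ (k - 1) := by
      rw [← pow_succ', show 4 = 2 ^ 2 from rfl, ← pow_mul]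
      exact pow_dvd_pow 2 (by omega)
    rw [map_pow_two_pow_of_metricForm_mul_left hq1 hq2]
    exact orderOf_dvd_iff_pow_eq_one.mp <| (orderOf_dvd_of_pow_eq_one <|
      map_pow_two_mul_eq_one hq1 hq2 (hx ▸ pow_orderOf_eq_one x)).trans hdvd
  have hord : orderOf (x ^ 2 ^ (k - 1)) = 2 := by
    rw [orderOf_pow_of_dvd (by positivity) (hx ▸ pow_dvd_pow 2 (Nat.sub_le k 1)), hx,
      Nat.pow_div (Nat.sub_le k 1) two_pos, show k - (k - 1) = 1 by omega, pow_one]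
  refine ⟨hq, ?_, ?_, by rw [Nat.card_zpowers, hord]⟩
  · intro h hh
    classical
    have hfin : IsOfFinOrder (x ^ 2 ^ (k - 1)) := orderOf_pos_iff.mp (by omega)
    obtain ⟨n, hn, rfl⟩ := Finset.mem_image.mp (hfin.mem_zpowers_iff_mem_range_orderOf.mp hh)
    rw [hord, Finset.mem_range] at hn
    interval_cases n
    · simpa using map_one_of_metricForm_mul_left hq2
    · simpa using hq
  · rw [Ne, Subgroup.zpowers_eq_bot, ← orderOf_eq_one_iff, hord]
    decide
end
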